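/- Let α, β be nonzero real numbers, and suppose liminf_{n→∞} n·(log n)·min{‖nβ/α‖, ‖nα/β‖} < ∞. Let f : ℝ → ℂ be measurable, with d₁,d₂,d₃,d₄ ∈ ℂ not all zero satisfying d₁f(x) + d₂f(x+1) + d₃f(x)e^{2πiαx} + d₄f(x+1)e^{2πiβx} = 0 for almost every x ∈ ℝ, and suppose f has minimal decay: for almost every x ∈ ℝ, f(x+n) → 0 as n → +∞ and as n → −∞ along the integers. Then f = 0 almost everywhere. -/

import Mathlib

open MeasureTheory Filter

/-- `e x = e^{2πix}`. -/
noncomputable def e (x : ℝ) : ℂ := Complex.exp (2 * Real.pi * Complex.I * x)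

/-- `nint x` is the distance from `x` to the nearest integer. -/
noncomputable def nint (x : ℝ) : ℝ := |x - round x|

lemma nint_nonneg (x : ℝ) : 0 ≤ nint x := abs_nonneg _

lemma nint_le_half (x : ℝ) : nint x ≤ 1 / 2 := abs_sub_round x

lemma nint_le (x : ℝ) (j : ℤ) : nint x ≤ |x - j| := round_le x j

lemma measurable_nint : Measurable nint := by
  have h : nint = fun x => min (Int.fract x) (1 - Int.fract x) := by
    funext x; exact abs_sub_round_eq_min x
  rw [h]
  exact measurable_fract.min (measurable_const.sub measurable_fract)

lemma nint_neg (x : ℝ) : nint (-x) = nint x := by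
  have h (y : ℝ) : nint (-y) ≤ nint y := by
    refine (nint_le (-y) (-round y)).trans_eq ?_
    rw [nint, ← abs_neg]
    push_cast
    ring_nf
  exact le_antisymm (h x) (by simpa using h (-x))

lemma nint_natCast_mul_le (l : ℕ) (x : ℝ) : nint (l * x) ≤ l * nint x := by
  refine (nint_le (l * x) (l * round x)).trans_eq ?_
  push_cast
  rw [← mul_sub, abs_mul, Nat.abs_cast, nint]

lemma e_add (x y : ℝ) : e (x + y) = e x * e y := by
  simp only [e, ← Complex.exp_add]
  push_cast
  ring_nf

lemma e_intCast (j : ℤ) : e j = 1 := by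
  rw [e, ← Complex.exp_int_mul_two_pi_mul_I j]
  push_cast
  ring_nf

lemma e_eq_exp_I_mul (x : ℝ) : e x = Complex.exp (Complex.I * ((2 * Real.pi * x : ℝ) : ℂ)) := by
  rw [e]
  push_cast
  ring_nf

lemma norm_e (x : ℝ) : ‖e x‖ = 1 := by
  rw [e_eq_exp_I_mul, mul_comm, Complex.norm_exp_ofReal_mul_I]

lemma e_sub_round (x : ℝ) : e (x - round x) = e x := by
  have := e_add (x - round x) (round x)
  rw [e_intCast, mul_one, sub_add_cancel] at this
  exact this.symm

lemma norm_e_sub_one_le (x : ℝ) : ‖e x - 1‖ ≤ 2 * Real.pi * nint x := by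
  rw [← e_sub_round, e_eq_exp_I_mul]
  refine Real.norm_exp_I_mul_ofReal_sub_one_le.trans_eq ?_
  rw [Real.norm_eq_abs, abs_mul, abs_of_pos Real.two_pi_pos, nint]

lemma nint_le_norm_e_sub_one (x : ℝ) : 4 * nint x ≤ ‖e x - 1‖ := by
  rw [← e_sub_round, e_eq_exp_I_mul, Complex.norm_exp_I_mul_ofReal_sub_one, Real.norm_eq_abs,
    abs_mul, abs_two]
  have h := abs_sub_round x
  have hπ := Real.pi_pos
  have := Real.mul_abs_le_abs_sin (x := 2 * Real.pi * (x - round x) / 2) (by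
    rw [mul_assoc, mul_div_cancel_left₀ _ two_ne_zero, abs_mul, abs_of_pos hπ]
    nlinarith)
  calc 4 * nint x = 2 * (2 / Real.pi * |2 * Real.pi * (x - round x) / 2|) := by
        rw [mul_assoc, mul_div_cancel_left₀ _ two_ne_zero, abs_mul, abs_of_pos hπ, nint]
        field_simp
        ring
    _ ≤ _ := by gcongr

/-- A nonzero polynomial of degree at most one in `e u` vanishes at most to first order. -/
lemma exists_nint_le_norm_add_mul_e {a b : ℂ} (hab : a ≠ 0 ∨ b ≠ 0) :
    ∃ c > 0, ∃ θ : ℝ, ∀ u : ℝ, c * nint (u - θ) ≤ ‖a + b * e u‖ := by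
  rcases eq_or_ne b 0 with rfl | hb
  · have ha : a ≠ 0 := by simpa using hab
    refine ⟨‖a‖, norm_pos_iff.2 ha, 0, fun u => ?_⟩
    have := nint_le_half (u - 0)
    simp only [zero_mul, add_zero]
    exact mul_le_of_le_one_right (norm_nonneg _) (by linarith)
  · set w : ℂ := -a / b with hw
    set θ : ℝ := w.arg / (2 * Real.pi) with hθ
    have hwθ : w = ‖w‖ * e θ := by
      rw [e_eq_exp_I_mul, hθ, mul_div_cancel₀ _ Real.two_pi_pos.ne', mul_comm Complex.I,
        Complex.norm_mul_exp_arg_mul_I]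
    refine ⟨‖b‖, norm_pos_iff.2 hb, θ, fun u => ?_⟩
    have h1 : a + b * e u = b * (e u - w) := by
      rw [hw]; field_simp; ring
    rw [h1, norm_mul]
    gcongr
    have h2 : ‖e θ - w‖ ≤ ‖e u - w‖ := by
      calc ‖e θ - w‖ = ‖(1 - ‖w‖ : ℂ) * e θ‖ := by
            conv_lhs => rw [hwθ]
            ring_nf
        _ = |1 - ‖w‖| := by
            rw [norm_mul, norm_e, mul_one, ← Real.norm_eq_abs, ← Complex.norm_real]
            push_cast
            rfl
        _ = |‖e u‖ - ‖w‖| := by rw [norm_e]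
        _ ≤ _ := abs_norm_sub_norm_le _ _
    have h3 : ‖e (u - θ) - 1‖ = ‖e u - e θ‖ := by
      have : e u - e θ = (e (u - θ) - 1) * e θ := by
        rw [sub_mul, ← e_add, sub_add_cancel, one_mul]
      rw [this, norm_mul, norm_e, mul_one]
    have h4 : ‖e u - e θ‖ ≤ ‖e u - w‖ + ‖e θ - w‖ := by
      have : e u - e θ = (e u - w) - (e θ - w) := by ring
      rw [this]; exact norm_sub_le _ _
    have h5 := nint_le_norm_e_sub_one (u - θ)
    have h6 := nint_nonneg (u - θ)
    linarith

/-- The points of a bounded interval where `β x + φ` is `r`-close to an integer have measure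
`O(r)`, uniformly in the phase `φ`. -/
lemma exists_measureReal_nint_le {β : ℝ} (hβ : β ≠ 0) {L : ℝ} (hL : 0 ≤ L) :
    ∃ K > 0, ∀ φ r : ℝ, 0 ≤ r →
      (volume.restrict (Set.Icc (-L) L)).real {x | nint (β * x + φ) ≤ r} ≤ K * r := by
  have hβ' := abs_pos.2 hβ
  refine ⟨(2 * (|β| * L) + 2) * (2 / |β|), by positivity, fun φ r hr => ?_⟩
  set F : Finset ℤ := Finset.Icc ⌈φ - |β| * L - 1 / 2⌉ ⌊φ + |β| * L + 1 / 2⌋ with hF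
  have hcard : (F.card : ℝ) ≤ 2 * (|β| * L) + 2 := by
    have h0 : 0 ≤ |β| * L := by positivity
    rw [hF, Int.card_Icc]
    have h1 := Int.floor_le (φ + |β| * L + 1 / 2)
    have h2 := Int.le_ceil (φ - |β| * L - 1 / 2)
    rcases le_total 0 (⌊φ + |β| * L + 1 / 2⌋ + 1 - ⌈φ - |β| * L - 1 / 2⌉) with h | h
    · have : (((⌊φ + |β| * L + 1 / 2⌋ + 1 - ⌈φ - |β| * L - 1 / 2⌉).toNat : ℤ) : ℝ) =
          ((⌊φ + |β| * L + 1 / 2⌋ + 1 - ⌈φ - |β| * L - 1 / 2⌉ : ℤ) : ℝ) := by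
        rw [Int.toNat_of_nonneg h]
      rw [Int.cast_natCast] at this
      rw [this]
      push_cast
      linarith
    · rw [Int.toNat_of_nonpos h]
      push_cast
      linarith
  have hcover : {x | nint (β * x + φ) ≤ r} ∩ Set.Icc (-L) L ⊆
      ⋃ j ∈ F, Metric.closedBall ((j - φ) / β) (r / |β|) := by
    rintro x ⟨hx, hxL⟩
    have hx : |β * x + φ - round (β * x + φ)| ≤ r := hx
    have hxL' : |β * x| ≤ |β| * L := by
      rw [abs_mul]; gcongr; exact abs_le.2 hxL
    have h1 := abs_le.1 hxL'
    have h2 := abs_le.1 (abs_sub_round (β * x + φ))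
    simp only [Set.mem_iUnion, Metric.mem_closedBall, Real.dist_eq]
    refine ⟨round (β * x + φ), ?_, ?_⟩
    · rw [hF, Finset.mem_Icc]
      exact ⟨Int.ceil_le.2 (by linarith), Int.le_floor.2 (by linarith)⟩
    · rw [le_div_iff₀ hβ', ← abs_mul]
      refine le_of_eq_of_le ?_ hx
      congr 1
      field_simp
      ring
  rw [measureReal_restrict_apply' measurableSet_Icc]
  calc volume.real ({x | nint (β * x + φ) ≤ r} ∩ Set.Icc (-L) L)
      ≤ volume.real (⋃ j ∈ F, Metric.closedBall (((j : ℝ) - φ) / β) (r / |β|)) := by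
        refine measureReal_mono hcover ?_
        exact (measure_biUnion_lt_top F.finite_toSet
          (fun j _ => measure_closedBall_lt_top)).ne
    _ ≤ ∑ j ∈ F, volume.real (Metric.closedBall (((j : ℝ) - φ) / β) (r / |β|)) :=
        measureReal_biUnion_finset_le _ _
    _ = F.card * (2 * (r / |β|)) := by
        simp [Real.volume_real_closedBall (show 0 ≤ r / |β| by positivity)]
    _ ≤ (2 * (|β| * L) + 2) * (2 * (r / |β|)) := by gcongr
    _ = _ := by ring

/-- Comparison of a truncated reciprocal with a counting function. -/
lemma inv_le_two_mul_sum_indicator {v : ℝ} {M : ℕ} (hpos : 0 < M) (hv : v ≤ 1)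
    (hM : (M : ℝ)⁻¹ < v) :
    v⁻¹ ≤ 2 * ∑ j ∈ Finset.range M, (if v ≤ ((j + 1 : ℕ) : ℝ)⁻¹ then 1 else 0 : ℝ) := by
  have hv0 : 0 < v := lt_of_le_of_lt (by positivity) hM
  have h1 : 1 ≤ v⁻¹ := (one_le_inv₀ hv0).2 hv
  have hfl : 1 ≤ ⌊v⁻¹⌋₊ := Nat.le_floor (by simpa using h1)
  have hMv : v⁻¹ ≤ M := by
    exact inv_le_of_inv_le₀ (by positivity) hM.le
  have hle : ⌊v⁻¹⌋₊ ≤ M := by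
    exact_mod_cast (Nat.floor_le (by positivity)).trans hMv
  calc v⁻¹ ≤ 2 * ⌊v⁻¹⌋₊ := by
        have := Nat.lt_floor_add_one v⁻¹
        have h2 : (1 : ℝ) ≤ ⌊v⁻¹⌋₊ := by exact_mod_cast hfl
        linarith
    _ = 2 * ∑ j ∈ Finset.range ⌊v⁻¹⌋₊, (1 : ℝ) := by simp
    _ ≤ 2 * ∑ j ∈ Finset.range ⌊v⁻¹⌋₊, (if v ≤ ((j + 1 : ℕ) : ℝ)⁻¹ then 1 else 0 : ℝ) := by
        gcongr with j hj
        rw [if_pos]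
        rw [le_inv_comm₀ hv0 (by positivity)]
        refine le_trans ?_ (Nat.floor_le (by positivity))
        exact_mod_cast Finset.mem_range.1 hj
    _ ≤ _ := by gcongr

/-- Off a set of small measure, the reciprocals of the distances to the integers along an orbit
segment of length `N` sum to `O(N log N)`. -/
lemma exists_sum_inv_nint_le {β : ℝ} (hβ : β ≠ 0) {L : ℝ} (hL : 0 ≤ L) (θ : ℝ)
    {ε : ℝ} (hε : 0 < ε) :
    ∃ C > 0, ∀ N : ℕ, 1 ≤ N → ∃ D : Set ℝ, MeasurableSet D ∧
      (volume.restrict (Set.Icc (-L) L)).real D ≤ ε ∧ ∀ x ∉ D,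
        (∀ k ∈ Finset.range N, 0 < nint (β * (x - (k + 1)) - θ)) ∧
        ∑ k ∈ Finset.range N, (nint (β * (x - (k + 1)) - θ))⁻¹ ≤ C * (N * (1 + Real.log N)) := by
  obtain ⟨K, hK, hKr⟩ := exists_measureReal_nint_le hβ hL
  set μ := volume.restrict (Set.Icc (-L) L) with hμ
  obtain ⟨q, hq⟩ := exists_nat_gt (2 * K / ε)
  have hq0 : (0 : ℝ) < q := lt_trans (by positivity) hq
  have hq1 : (1 : ℝ) ≤ q := by exact_mod_cast Nat.cast_pos.1 hq0
  have hlq : 0 ≤ Real.log q := Real.log_nonneg hq1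
  refine ⟨4 * K * (1 + Real.log q) / ε, by positivity, fun N hN => ?_⟩
  have hN1 : (1 : ℝ) ≤ N := by exact_mod_cast hN
  have hlN : 0 ≤ Real.log N := Real.log_nonneg hN1
  set M : ℕ := N * q with hM
  have hMpos : 0 < M := Nat.mul_pos hN (Nat.cast_pos.1 hq0)
  have hlM : Real.log M = Real.log N + Real.log q := by
    rw [hM, Nat.cast_mul, Real.log_mul (by positivity) (by positivity)]
  set v : ℕ → ℝ → ℝ := fun k x => nint (β * x + (-β * (k + 1) - θ)) with hv
  have hvm (k : ℕ) : Measurable (v k) :=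
    measurable_nint.comp ((measurable_id.const_mul β).add_const _)
  have hset (k : ℕ) (r : ℝ) : MeasurableSet {x | v k x ≤ r} :=
    measurableSet_le (hvm k) measurable_const
  set h : ℝ → ℝ := fun x => ∑ k ∈ Finset.range N, ∑ j ∈ Finset.range M,
    Set.indicator {x | v k x ≤ ((j + 1 : ℕ) : ℝ)⁻¹} (fun _ => (1 : ℝ)) x with hh
  have hind (k j : ℕ) : Integrable
      (Set.indicator {x | v k x ≤ ((j + 1 : ℕ) : ℝ)⁻¹} (fun _ => (1 : ℝ))) μ :=
    (integrable_const 1).indicator (hset k _)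
  have hhi : Integrable h μ :=
    integrable_finsetSum _ fun k _ => integrable_finsetSum _ fun j _ => hind k j
  have hh0 : 0 ≤ h := fun x => Finset.sum_nonneg fun k _ => Finset.sum_nonneg fun j _ =>
    Set.indicator_nonneg (fun _ _ => zero_le_one) x
  have hint : ∫ x, h x ∂μ ≤ N * K * (1 + Real.log M) := by
    rw [hh, integral_finsetSum _ fun k _ => integrable_finsetSum _ fun j _ => hind k j]
    calc ∑ k ∈ Finset.range N, ∫ x, ∑ j ∈ Finset.range M,
          Set.indicator {x | v k x ≤ ((j + 1 : ℕ) : ℝ)⁻¹} (fun _ => (1 : ℝ)) x ∂μ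
        ≤ ∑ k ∈ Finset.range N, K * (1 + Real.log M) := by
          refine Finset.sum_le_sum fun k _ => ?_
          rw [integral_finsetSum _ fun j _ => hind k j]
          calc _ ≤ ∑ j ∈ Finset.range M, K * ((j + 1 : ℕ) : ℝ)⁻¹ := by
                refine Finset.sum_le_sum fun j _ => ?_
                rw [integral_indicator_const _ (hset k _), smul_eq_mul, mul_one]
                exact hKr _ _ (by positivity)
            _ = K * (harmonic M : ℝ) := by
                rw [← Finset.mul_sum, harmonic]
                push_cast
                rfl
            _ ≤ _ := by
                gcongr
                exact harmonic_le_one_add_log M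
      _ = _ := by simp [mul_assoc]
  set lam : ℝ := 2 * N * K * (1 + Real.log M) / ε with hlam
  have hlam0 : 0 < lam := by
    have : 0 ≤ Real.log M := by rw [hlM]; positivity
    positivity
  have hD2 : μ.real {x | lam ≤ h x} ≤ ε / 2 := by
    have h1 := mul_meas_ge_le_integral_of_nonneg (Eventually.of_forall hh0) hhi lam
    have h2 : lam * (ε / 2) = N * K * (1 + Real.log M) := by
      rw [hlam]; field_simp
    refine le_of_mul_le_mul_left ?_ hlam0
    rw [h2]
    exact h1.trans hint
  have hD1 : μ.real (⋃ k ∈ Finset.range N, {x | v k x ≤ (M : ℝ)⁻¹}) ≤ ε / 2 := by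
    calc _ ≤ ∑ k ∈ Finset.range N, μ.real {x | v k x ≤ (M : ℝ)⁻¹} :=
          measureReal_biUnion_finset_le _ _
      _ ≤ ∑ k ∈ Finset.range N, K * (M : ℝ)⁻¹ :=
          Finset.sum_le_sum fun k _ => hKr _ _ (by positivity)
      _ = K / q := by
          rw [Finset.sum_const, Finset.card_range, nsmul_eq_mul, hM]
          push_cast
          field_simp
      _ ≤ ε / 2 := by
          rw [div_lt_iff₀ hε] at hq
          rw [div_le_div_iff₀ hq0 two_pos]
          linarith
  refine ⟨(⋃ k ∈ Finset.range N, {x | v k x ≤ (M : ℝ)⁻¹}) ∪ {x | lam ≤ h x}, ?_, ?_, ?_⟩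
  · refine (Finset.measurableSet_biUnion _ fun k _ => hset k _).union
      (measurableSet_le measurable_const ?_)
    exact Finset.measurable_sum _ fun k _ => Finset.measurable_sum _ fun j _ =>
      measurable_const.indicator (hset k _)
  · exact (measureReal_union_le _ _).trans (by linarith)
  · intro x hx
    simp only [Set.mem_union, Set.mem_iUnion, Set.mem_ofPred_eq, not_or, not_exists, not_le] at hx
    obtain ⟨hx1, hx2⟩ := hx
    have hvx (k : ℕ) : nint (β * (x - (k + 1)) - θ) = v k x := by
      simp only [hv]
      ring_nf
    simp only [hvx]
    refine ⟨fun k hk => lt_of_le_of_lt (by positivity) (hx1 k hk), ?_⟩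
    calc ∑ k ∈ Finset.range N, (v k x)⁻¹
        ≤ ∑ k ∈ Finset.range N, 2 * ∑ j ∈ Finset.range M,
            Set.indicator {x | v k x ≤ ((j + 1 : ℕ) : ℝ)⁻¹} (fun _ => (1 : ℝ)) x := by
          refine Finset.sum_le_sum fun k hk => ?_
          refine (inv_le_two_mul_sum_indicator hMpos ?_ (hx1 k hk)).trans_eq ?_
          · exact (nint_le_half _).trans (by norm_num)
          · simp [Set.indicator_apply]
      _ = 2 * h x := by rw [← Finset.mul_sum]
      _ ≤ 2 * lam := by linarith
      _ = 4 * K / ε * (N * (1 + Real.log N + Real.log q)) := by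
          rw [hlam, hlM]; ring
      _ ≤ 4 * K / ε * (N * ((1 + Real.log q) * (1 + Real.log N))) := by
          gcongr
          nlinarith [mul_nonneg hlq hlN]
      _ = _ := by ring

/-- If two orbits of a first-order recurrence share the coefficient `P` and have comparable
coefficients `Q`, their growth is comparable. -/
lemma norm_mul_norm_le_exp_sum {f P Q : ℝ → ℂ} {u v : ℝ} {a : ℕ → ℝ} {n : ℕ}
    (hu : ∀ k < n, f (u + k) * P (u + k) + f (u + k + 1) * Q (u + k) = 0)
    (hv : ∀ k < n, f (v + k) * P (v + k) + f (v + k + 1) * Q (v + k) = 0)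
    (hP : ∀ k < n, P (v + k) = P (u + k)) (hQ0 : ∀ k < n, Q (u + k) ≠ 0)
    (hQ : ∀ k < n, ‖Q (v + k)‖ ≤ (1 + a k) * ‖Q (u + k)‖) :
    ‖f (u + n)‖ * ‖f v‖ ≤ Real.exp (∑ k ∈ Finset.range n, a k) * (‖f u‖ * ‖f (v + n)‖) := by
  induction n with
  | zero => simp
  | succ n ih =>
    have ih' := ih (fun k hk => hu k (by omega)) (fun k hk => hv k (by omega))
      (fun k hk => hP k (by omega)) (fun k hk => hQ0 k (by omega)) (fun k hk => hQ k (by omega))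
    have hu' := congrArg norm (eq_neg_of_add_eq_zero_left (hu n n.lt_succ_self))
    have hv' := congrArg norm (eq_neg_of_add_eq_zero_left (hv n n.lt_succ_self))
    rw [norm_neg, norm_mul, norm_mul] at hu' hv'
    rw [hP n n.lt_succ_self] at hv'
    have hq : 0 < ‖Q (u + n)‖ := norm_pos_iff.2 (hQ0 n n.lt_succ_self)
    have hexp : 1 + a n ≤ Real.exp (a n) := by
      have := Real.add_one_le_exp (a n)
      linarith
    rw [Finset.sum_range_succ, Real.exp_add, Nat.cast_succ, ← add_assoc, ← add_assoc]
    refine le_of_mul_le_mul_right ?_ hq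
    set S := Real.exp (∑ k ∈ Finset.range n, a k)
    calc ‖f (u + n + 1)‖ * ‖f v‖ * ‖Q (u + n)‖
        = (‖f (u + n)‖ * ‖f v‖) * ‖P (u + n)‖ := by rw [mul_right_comm, ← hu']; ring
      _ ≤ (S * (‖f u‖ * ‖f (v + n)‖)) * ‖P (u + n)‖ := by gcongr
      _ = S * ‖f u‖ * (‖f (v + n + 1)‖ * ‖Q (v + n)‖) := by rw [← hv']; ring
      _ ≤ S * ‖f u‖ * (‖f (v + n + 1)‖ * (Real.exp (a n) * ‖Q (u + n)‖)) := by
          have := (hQ n n.lt_succ_self).trans (mul_le_mul_of_nonneg_right hexp hq.le)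
          gcongr
      _ = _ := by ring

/-- A nonzero function decaying along integer translates is bounded below, and decays uniformly,
on a bounded set of positive measure all of whose integer translates satisfy a given almost
everywhere property. -/
lemma exists_set_uniform_decay {f : ℝ → ℂ} (hf : Measurable f) {R : ℝ → Prop}
    (hR : ∀ᵐ x : ℝ, R x)
    (hdecay : ∀ᵐ x : ℝ, Tendsto (fun n : ℤ => f (x + n)) atTop (nhds 0) ∧
      Tendsto (fun n : ℤ => f (x + n)) atBot (nhds 0))
    (hne : ¬ ∀ᵐ x : ℝ, f x = 0) :
    ∃ L : ℕ, ∃ η > 0, ∃ A : Set ℝ, MeasurableSet A ∧ A ⊆ Set.Icc (-L : ℝ) L ∧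
      0 < volume A ∧ (∀ x ∈ A, η < ‖f x‖) ∧ (∀ x ∈ A, ∀ k : ℤ, R (x + k)) ∧
      ∀ ε > 0, ∀ᶠ n : ℕ in atTop, ∀ x ∈ A, ‖f (x + n)‖ < ε ∧ ‖f (x - n)‖ < ε := by
  set U : ℕ → Set ℝ := fun L => Set.Icc (-L : ℝ) L ∩ {x | ((L : ℝ) + 1)⁻¹ < ‖f x‖} with hU
  have hUm (L : ℕ) : MeasurableSet (U L) :=
    measurableSet_Icc.inter (measurableSet_lt measurable_const hf.norm)
  obtain ⟨L, hL⟩ : ∃ L, 0 < volume (U L) := by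
    by_contra! hcon
    refine hne ?_
    have hzero : volume (⋃ L, U L) = 0 :=
      measure_iUnion_null fun L => le_antisymm (hcon L) zero_le
    refine measure_mono_null (fun x hx => ?_) hzero
    have hx : 0 < ‖f x‖ := norm_pos_iff.2 hx
    obtain ⟨n, hn⟩ := exists_nat_gt (max |x| ‖f x‖⁻¹)
    have hn1 := (le_max_left _ _).trans_lt hn
    have hn2 := (le_max_right _ _).trans_lt hn
    refine Set.mem_iUnion.2 ⟨n, ⟨abs_le.1 hn1.le, ?_⟩⟩
    exact inv_lt_of_inv_lt₀ hx (by linarith)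
  have hUfin : volume (U L) ≠ ⊤ :=
    ((measure_mono Set.inter_subset_left).trans_lt measure_Icc_lt_top).ne
  have hRk : ∀ᵐ x : ℝ, ∀ k : ℤ, R (x + k) := by
    rw [ae_all_iff]
    intro k
    exact (measurePreserving_add_right volume (k : ℝ)).quasiMeasurePreserving.ae hR
  set Z := toMeasurable volume {x : ℝ | ¬ ∀ k : ℤ, R (x + k)} with hZ
  have hZ0 : volume Z = 0 := by rw [hZ, measure_toMeasurable]; exact hRk
  obtain ⟨V, hVU, hVm, hV, hunif⟩ := tendstoUniformlyOn_of_ae_tendsto (μ := volume)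
    (f := fun (n : ℕ) (x : ℝ) => ‖f (x + n)‖ + ‖f (x - n)‖) (g := fun _ => (0 : ℝ))
    (fun n => ((hf.comp (measurable_add_const _)).norm.add
      (hf.comp (measurable_sub_const _)).norm).stronglyMeasurable)
    stronglyMeasurable_const (hUm L) hUfin
    (by
      filter_upwards [hdecay] with x hx _
      have h1 : Tendsto (fun n : ℕ => f (x + n)) atTop (nhds 0) := by
        simpa [Function.comp_def] using hx.1.comp tendsto_natCast_atTop_atTop
      have h2 : Tendsto (fun n : ℕ => f (x - n)) atTop (nhds 0) := by
        have : Tendsto (fun n : ℕ => -(n : ℤ)) atTop atBot :=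
          tendsto_neg_atTop_atBot.comp tendsto_natCast_atTop_atTop
        simpa [Function.comp_def, sub_eq_add_neg] using hx.2.comp this
      simpa using h1.norm.add h2.norm)
    (ε := (volume (U L)).toReal / 2) (half_pos (ENNReal.toReal_pos hL.ne' hUfin))
  have hVlt : volume V < volume (U L) := by
    refine hV.trans_lt ?_
    rw [ENNReal.ofReal_lt_iff_lt_toReal (by positivity) hUfin]
    exact half_lt_self (ENNReal.toReal_pos hL.ne' hUfin)
  refine ⟨L, ((L : ℝ) + 1)⁻¹, by positivity, (U L \ V) \ Z,
    ((hUm L).diff hVm).diff (measurableSet_toMeasurable _ _), fun x hx => hx.1.1.1, ?_,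
    fun x hx => hx.1.1.2, fun x hx => ?_, fun ε hε => ?_⟩
  · rw [measure_sdiff_null hZ0]
    exact (tsub_pos_of_lt hVlt).trans_le le_measure_sdiff
  · by_contra hcon
    exact hx.2 (subset_toMeasurable _ _ hcon)
  · filter_upwards [Metric.tendstoUniformlyOn_iff.1 hunif ε hε] with n hn x hx
    have := hn x hx.1
    rw [dist_comm, dist_zero_right, Real.norm_eq_abs] at this
    have h1 := norm_nonneg (f (x + n))
    have h2 := norm_nonneg (f (x - n))
    have h3 := (abs_lt.1 this).2
    constructor <;> linarith

/-- Among sufficiently many translates of a set of positive measure, by fractional parts of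
multiples of `t`, two intersect. -/
lemma exists_lt_mem_add_sub_fract {A : Set ℝ} (hA : MeasurableSet A) {L : ℝ} (hL : 0 ≤ L)
    (hAL : A ⊆ Set.Icc (-L) L) {J : ℕ} (hJ : 2 * L + 1 < J * volume.real A) (t : ℝ) :
    ∃ i j : ℕ, i < j ∧ j < J ∧ ∃ x ∈ A, x + Int.fract (j * t) - Int.fract (i * t) ∈ A := by
  set ν := volume.restrict (Set.Icc (-L) (L + 1)) with hν
  set W : ℕ → Set ℝ := fun j => (fun x => x + -Int.fract (j * t)) ⁻¹' A with hW
  have hWm (j : ℕ) : MeasurableSet (W j) := measurable_add_const _ hA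
  have hWν (j : ℕ) : ν.real (W j) = volume.real A := by
    rw [hν, measureReal_restrict_apply (hWm j), Set.inter_eq_left.2, measureReal_def,
      measure_preimage_add_right, measureReal_def]
    intro x hx
    have hx' := hAL hx
    have h1 := Int.fract_nonneg ((j : ℝ) * t)
    have h2 := Int.fract_lt_one ((j : ℝ) * t)
    constructor <;> linarith [hx'.1, hx'.2]
  obtain ⟨i, hi, j, hj, hij, x, hxi, hxj⟩ :=
    exists_nonempty_inter_of_measureReal_univ_lt_sum_measureReal (μ := ν) (s := Finset.range J)
      (t := W) (fun j _ => hWm j) (by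
        simp only [hWν, Finset.sum_const, Finset.card_range, nsmul_eq_mul]
        rw [hν, measureReal_restrict_apply MeasurableSet.univ, Set.univ_inter,
          Real.volume_real_Icc_of_le (by linarith)]
        linarith)
  have key {i j : ℕ} (hxi : x ∈ W i) (hxj : x ∈ W j) :
      x + -Int.fract (j * t) + Int.fract (j * t) - Int.fract (i * t) ∈ A := by
    rw [neg_add_cancel_right, sub_eq_add_neg]
    exact hxi
  rcases lt_or_gt_of_ne hij with h | h
  · exact ⟨i, j, h, Finset.mem_range.1 hj, _, hxj, key hxi hxj⟩
  · exact ⟨j, i, h, Finset.mem_range.1 hi, _, hxi, key hxj hxi⟩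

/-- Relative perturbation of a polynomial of degree at most one in `e u` under a shift. -/
lemma norm_add_mul_e_add_le {a b : ℂ} {c v u : ℝ} (hc : 0 < c) (hv : 0 < v)
    (h : c * v ≤ ‖a + b * e u‖) (τ : ℝ) :
    ‖a + b * e (u + τ)‖ ≤ (1 + 2 * Real.pi * ‖b‖ / c * nint τ * v⁻¹) * ‖a + b * e u‖ := by
  have hdecomp : a + b * e (u + τ) = (a + b * e u) + b * e u * (e τ - 1) := by
    rw [e_add]; ring
  have hτ := nint_nonneg τ
  have hb : ‖b * e u * (e τ - 1)‖ ≤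
      2 * Real.pi * ‖b‖ / c * nint τ * v⁻¹ * ‖a + b * e u‖ := by
    rw [norm_mul, norm_mul, norm_e, mul_one]
    calc ‖b‖ * ‖e τ - 1‖ ≤ ‖b‖ * (2 * Real.pi * nint τ) := by
          gcongr
          exact norm_e_sub_one_le τ
      _ = 2 * Real.pi * ‖b‖ / c * nint τ * v⁻¹ * (c * v) := by field_simp
      _ ≤ _ := by gcongr
  rw [hdecomp, add_mul, one_mul]
  exact (norm_add_le _ _).trans (by gcongr)

lemma mul_one_add_log_mul_le {R m : ℝ} (hR : 1 ≤ R) (hm : 2 ≤ m) :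
    R * m * (1 + Real.log (R * m)) ≤ 3 * R * (1 + Real.log R) * (m * Real.log m) := by
  have hlR := Real.log_nonneg hR
  have hlm : 1 ≤ 2 * Real.log m := by
    have h1 := Real.log_two_gt_d9
    have h2 := Real.log_le_log two_pos hm
    linarith
  rw [Real.log_mul (by positivity) (by positivity)]
  calc R * m * (1 + (Real.log R + Real.log m))
      ≤ R * m * (3 * (1 + Real.log R) * Real.log m) := by
        gcongr
        nlinarith
    _ = _ := by ring

/-- A decaying solution of `f x * P x + f (x + 1) * Q x = 0` vanishes when `P` has period `p` and
suitable multiples of `p` are almost periods of `Q x = a + b * e (β * x)`. -/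
lemma ae_eq_zero_of_periodic_of_decay {P : ℝ → ℂ} {p β : ℝ} (hp : 0 < p)
    (hP : Function.Periodic P p) (hβ : β ≠ 0) {a b : ℂ} (hab : a ≠ 0 ∨ b ≠ 0)
    (hdio : ∃ c : ℝ, ∃ᶠ m : ℕ in atTop, (m : ℝ) * Real.log m * nint (m * (β * p)) ≤ c)
    {f : ℝ → ℂ} (hf : Measurable f)
    (heq : ∀ᵐ x : ℝ, f x * P x + f (x + 1) * (a + b * e (β * x)) = 0)
    (hdecay : ∀ᵐ x : ℝ, Tendsto (fun n : ℤ => f (x + n)) atTop (nhds 0) ∧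
      Tendsto (fun n : ℤ => f (x + n)) atBot (nhds 0)) :
    ∀ᵐ x : ℝ, f x = 0 := by
  by_contra hne
  obtain ⟨L, η, hη, A, hAm, hAL, hA0, hAη, hAR, hAunif⟩ :=
    exists_set_uniform_decay hf heq hdecay hne
  obtain ⟨c₀, hc₀⟩ := hdio
  obtain ⟨c, hc, θ, hcθ⟩ := exists_nint_le_norm_add_mul_e hab
  have hL : (0 : ℝ) ≤ L := L.cast_nonneg
  have hAfin : volume A ≠ ⊤ := ((measure_mono hAL).trans_lt measure_Icc_lt_top).ne
  set s := volume.real A with hs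
  have hs0 : 0 < s := ENNReal.toReal_pos hA0.ne' hAfin
  obtain ⟨C, hC, hCN⟩ := exists_sum_inv_nint_le hβ hL θ (half_pos hs0)
  obtain ⟨J, hJ⟩ := exists_nat_gt ((2 * L + 1) / (s / 2))
  rw [div_lt_iff₀ (half_pos hs0)] at hJ
  obtain ⟨R, hR⟩ := exists_nat_gt (J * p + 1)
  have hJ0 : (0 : ℝ) ≤ J := J.cast_nonneg
  have hR1 : (1 : ℝ) < R := lt_of_le_of_lt (by nlinarith) hR
  have hlR : 0 < Real.log R := Real.log_pos hR1
  set B : ℝ := 2 * Real.pi * ‖b‖ / c with hB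
  have hB0 : 0 ≤ B := by positivity
  set E : ℝ := B * J * C * (3 * R * (1 + Real.log R)) * c₀ with hE
  set ε : ℝ := η * Real.exp (-E / 2) with hε
  have hε0 : 0 < ε := by positivity
  obtain ⟨n₀, hn₀⟩ := eventually_atTop.1 (hAunif ε hε0)
  obtain ⟨m₀, hm₀⟩ := exists_nat_gt (((n₀ : ℝ) + 1) / p)
  rw [div_lt_iff₀ hp] at hm₀
  obtain ⟨m, hmc, hm2, hmm₀⟩ := (hc₀.and_eventually
    ((eventually_ge_atTop 2).and (eventually_ge_atTop m₀))).exists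
  have hm2' : (2 : ℝ) ≤ m := by exact_mod_cast hm2
  have hmp : (n₀ : ℝ) + 1 < m * p := by
    have : (m₀ : ℝ) ≤ m := by exact_mod_cast hmm₀
    nlinarith
  obtain ⟨D, hDm, hD, hDx⟩ := hCN (R * m) (by
    have : 0 < R := by exact_mod_cast zero_lt_one.trans hR1
    exact Nat.mul_pos this (by omega))
  have hAD : s / 2 ≤ volume.real (A \ D) := by
    have h1 : volume.real (A ∩ D) ≤ s / 2 := by
      refine le_trans ?_ hD
      rw [measureReal_restrict_apply hDm, Set.inter_comm]
      exact measureReal_mono (Set.inter_subset_inter_right _ hAL)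
        ((measure_mono Set.inter_subset_right).trans_lt measure_Icc_lt_top).ne
    have h2 := measureReal_inter_add_sdiff (μ := volume) (s := A) hDm hAfin
    linarith
  obtain ⟨i, j, hij, hjJ, x, hx, hy⟩ := exists_lt_mem_add_sub_fract (hAm.diff hDm) hL
    (fun x hx => hAL hx.1) (J := J) (hJ.trans_le (by gcongr)) (m * p)
  set y := x + Int.fract ((j : ℝ) * (m * p)) - Int.fract ((i : ℝ) * (m * p)) with hydef
  obtain ⟨l, rfl⟩ : ∃ l, j = i + l := ⟨j - i, by omega⟩
  have hl1 : (1 : ℝ) ≤ l := by exact_mod_cast (by omega : 1 ≤ l)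
  have hlJ : (l : ℝ) ≤ J := by exact_mod_cast (by omega : l ≤ J)
  set T : ℝ := l * (m * p) with hT
  have hmp0 : 0 < m * p := by positivity
  obtain ⟨n, hn⟩ : ∃ n : ℕ,
      (n : ℤ) = ⌊((i + l : ℕ) : ℝ) * (m * p)⌋ - ⌊(i : ℝ) * (m * p)⌋ := by
    refine Int.eq_ofNat_of_zero_le (sub_nonneg.2 (Int.floor_le_floor ?_)) |>.imp
      fun _ h => h.symm
    gcongr
  have hnT : (n : ℝ) = T - Int.fract (((i + l : ℕ) : ℝ) * (m * p)) +
      Int.fract ((i : ℝ) * (m * p)) := by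
    rw [← Int.cast_natCast, hn, Int.cast_sub, Int.fract, Int.fract, hT]
    push_cast
    ring
  have hyT : y = x - n + T := by rw [hnT, hydef]; ring
  have hf1 := Int.fract_nonneg (((i + l : ℕ) : ℝ) * (m * p))
  have hf2 := Int.fract_lt_one (((i + l : ℕ) : ℝ) * (m * p))
  have hf3 := Int.fract_nonneg ((i : ℝ) * (m * p))
  have hf4 := Int.fract_lt_one ((i : ℝ) * (m * p))
  have hTm : m * p ≤ T := by rw [hT]; nlinarith
  have hTJ : T ≤ J * (m * p) := by rw [hT]; gcongr
  have hn_lower : n₀ ≤ n := by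
    have : (n₀ : ℝ) < n := by linarith
    exact_mod_cast this.le
  have hn_upper : n ≤ R * m := by
    have : (n : ℝ) ≤ R * m := by nlinarith
    exact_mod_cast this
  set δ := nint (m * (β * p)) with hδ
  have hδ0 : 0 ≤ δ := nint_nonneg _
  have hδT : nint (β * T) ≤ J * δ := by
    calc nint (β * T) = nint (l * (m * (β * p))) := by rw [hT]; ring_nf
      _ ≤ l * δ := nint_natCast_mul_le _ _
      _ ≤ J * δ := by gcongr
  set g : ℕ → ℝ := fun k => (nint (β * (x - (k + 1)) - θ))⁻¹ with hg
  have hg0 (k : ℕ) : 0 ≤ g k := inv_nonneg.2 (nint_nonneg _)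
  obtain ⟨hpos, hsum⟩ := hDx x hx.2
  have hidx (k : ℕ) (hk : k < n) : x - n + k = x - (((n - 1 - k : ℕ) : ℝ) + 1) := by
    obtain ⟨r, rfl⟩ : ∃ r, n = k + 1 + r := ⟨n - (k + 1), by omega⟩
    have : k + 1 + r - 1 - k = r := by omega
    rw [this]
    push_cast
    ring
  have hlow (k : ℕ) (hk : k < n) :
      c * (g (n - 1 - k))⁻¹ ≤ ‖a + b * e (β * (x - n + k))‖ ∧ 0 < g (n - 1 - k) := by
    refine ⟨?_, inv_pos.2 (hpos _ (Finset.mem_range.2 (by omega)))⟩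
    rw [hidx k hk, hg, inv_inv]
    exact hcθ _
  have hmain : ‖f (x - n + n)‖ * ‖f y‖ ≤
      Real.exp (∑ k ∈ Finset.range n, B * nint (β * T) * g (n - 1 - k)) *
        (‖f (x - n)‖ * ‖f (y + n)‖) := by
    refine norm_mul_norm_le_exp_sum (P := P) (Q := fun x => a + b * e (β * x)) ?_ ?_ ?_ ?_ ?_
    · intro k _
      have := hAR x hx.1 (-n + k)
      push_cast at this
      rwa [← add_assoc, ← sub_eq_add_neg] at this
    · intro k _
      exact_mod_cast hAR y hy.1 k
    · intro k _
      have h1 := hP.nat_mul (l * m) (x - n + k)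
      rw [← h1, hyT, hT]
      push_cast
      ring_nf
    · intro k hk
      obtain ⟨h1, h2⟩ := hlow k hk
      exact norm_pos_iff.1 (lt_of_lt_of_le (by positivity) h1)
    · intro k hk
      obtain ⟨h1, h2⟩ := hlow k hk
      have := norm_add_mul_e_add_le hc (inv_pos.2 h2) h1 (β * T)
      rw [inv_inv] at this
      rwa [hyT, show β * (x - n + T + k) = β * (x - n + k) + β * T by ring]
  have hbound : ∑ k ∈ Finset.range n, B * nint (β * T) * g (n - 1 - k) ≤ E := by
    have hsum' : ∑ k ∈ Finset.range n, g k ≤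
        C * (3 * R * (1 + Real.log R) * (m * Real.log m)) := by
      refine le_trans (Finset.sum_le_sum_of_subset_of_nonneg
        (Finset.range_subset_range.2 hn_upper) fun k _ _ => hg0 k) (hsum.trans ?_)
      rw [Nat.cast_mul]
      exact mul_le_mul_of_nonneg_left (mul_one_add_log_mul_le hR1.le hm2') hC.le
    rw [← Finset.mul_sum, Finset.sum_range_reflect]
    calc B * nint (β * T) * ∑ k ∈ Finset.range n, g k
        ≤ B * (J * δ) * (C * (3 * R * (1 + Real.log R) * (m * Real.log m))) :=
          mul_le_mul (mul_le_mul_of_nonneg_left hδT hB0) hsum'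
            (Finset.sum_nonneg fun k _ => hg0 k) (by positivity)
      _ = B * J * C * (3 * R * (1 + Real.log R)) * (m * Real.log m * δ) := by ring
      _ ≤ E := by
          rw [hE]
          gcongr
  rw [sub_add_cancel] at hmain
  have hfu := (hn₀ n hn_lower x hx.1).2
  have hfv := (hn₀ n hn_lower y hy.1).1
  have hcontra : η * η < η * η := by
    calc η * η < ‖f x‖ * ‖f y‖ :=
          mul_lt_mul'' (hAη x hx.1) (hAη y hy.1) hη.le hη.le
      _ ≤ Real.exp E * (ε * ε) := hmain.trans (by gcongr)
      _ = η * η * (Real.exp E * (Real.exp (-E / 2) * Real.exp (-E / 2))) := by rw [hε]; ring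
      _ = η * η := by
          rw [← Real.exp_add, ← Real.exp_add]
          ring_nf
          simp
  exact lt_irrefl _ hcontra

lemma periodic_add_mul_e (a b : ℂ) {α : ℝ} (hα : α ≠ 0) :
    Function.Periodic (fun x => a + b * e (α * x)) |α|⁻¹ := by
  intro x
  have h : e (α * |α|⁻¹) = 1 := by
    rcases abs_choice α with h | h
    · rw [h, mul_inv_cancel₀ hα]
      exact_mod_cast e_intCast 1
    · rw [h, inv_neg, mul_neg, mul_inv_cancel₀ hα]
      exact_mod_cast e_intCast (-1)
  simp only [mul_add, e_add, h, mul_one]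

lemma nint_mul_abs_inv (m : ℕ) (α β : ℝ) :
    nint (m * (β * |α|⁻¹)) = nint (m * (β / α)) := by
  rcases abs_choice α with h | h
  · rw [h, div_eq_mul_inv]
  · rw [h, inv_neg, mul_neg, mul_neg, nint_neg, div_eq_mul_inv]

lemma ae_add_mul_e_ne_zero {a b : ℂ} (hab : a ≠ 0 ∨ b ≠ 0) {α : ℝ} (hα : α ≠ 0) :
    ∀ᵐ x : ℝ, a + b * e (α * x) ≠ 0 := by
  obtain ⟨c, hc, θ, hcθ⟩ := exists_nint_le_norm_add_mul_e hab
  rw [ae_iff]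
  have hcover : {x : ℝ | ¬ (a + b * e (α * x) ≠ 0)} ⊆ Set.range fun j : ℤ => (j + θ) / α := by
    intro x hx
    have hx : a + b * e (α * x) = 0 := not_not.1 hx
    have h := hcθ (α * x)
    rw [hx, norm_zero] at h
    have h0 : |α * x - θ - round (α * x - θ)| = 0 :=
      le_antisymm (nonpos_of_mul_nonpos_right h hc) (abs_nonneg _)
    refine ⟨round (α * x - θ), ?_⟩
    have := abs_eq_zero.1 h0
    dsimp only
    rw [div_eq_iff hα]
    linarith
  exact measure_mono_null hcover ((Set.countable_range _).measure_zero volume)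

/-- For the special (2,2) configuration `(0,0),(1,0),(0,α),(1,β)` with the Diophantine
condition `liminf n (log n) min{‖nβ/α‖,‖nα/β‖} < ∞`, no nontrivial measurable solution
with minimal decay along integer translates exists. -/
theorem hrt_minimal_decay_special_two_two_diophantine
    (α β : ℝ) (hα : α ≠ 0) (hβ : β ≠ 0)
    (hdio : ∃ c : ℝ, ∃ᶠ n : ℕ in atTop,
      (n : ℝ) * Real.log n * min (nint ((n : ℝ) * (β / α))) (nint ((n : ℝ) * (α / β))) ≤ c)
    (f : ℝ → ℂ) (hf : Measurable f)
    (d : Fin 4 → ℂ) (hd : ∃ i, d i ≠ 0)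
    (heq : ∀ᵐ x : ℝ, d 0 * f x + d 1 * f (x + 1) + d 2 * f x * e (α * x)
      + d 3 * f (x + 1) * e (β * x) = 0)
    (hdecay : ∀ᵐ x : ℝ, Tendsto (fun n : ℤ => f (x + n)) atTop (nhds 0) ∧
      Tendsto (fun n : ℤ => f (x + n)) atBot (nhds 0)) :
    ∀ᵐ x : ℝ, f x = 0 := by
  have heq' : ∀ᵐ x : ℝ, f x * (d 0 + d 2 * e (α * x)) +
      f (x + 1) * (d 1 + d 3 * e (β * x)) = 0 := by
    filter_upwards [heq] with x hx
    rw [← hx]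
    ring
  by_cases h13 : d 1 ≠ 0 ∨ d 3 ≠ 0
  swap
  · obtain ⟨h1, h3⟩ : d 1 = 0 ∧ d 3 = 0 := by simpa using h13
    have h02 : d 0 ≠ 0 ∨ d 2 ≠ 0 := by
      obtain ⟨i, hi⟩ := hd
      fin_cases i <;> simp_all
    filter_upwards [heq', ae_add_mul_e_ne_zero h02 hα] with x hx hx0
    simpa [h1, h3, hx0] using hx
  by_cases h02 : d 0 ≠ 0 ∨ d 2 ≠ 0
  swap
  · obtain ⟨h0, h2⟩ : d 0 = 0 ∧ d 2 = 0 := by simpa using h02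
    have : ∀ᵐ x : ℝ, f (x + 1) = 0 := by
      filter_upwards [heq', ae_add_mul_e_ne_zero h13 hβ] with x hx hx0
      simpa [h0, h2, hx0] using hx
    simpa using (measurePreserving_sub_right volume (1 : ℝ)).quasiMeasurePreserving.ae this
  obtain ⟨c, hc⟩ := hdio
  have hor : (∃ᶠ n : ℕ in atTop, (n : ℝ) * Real.log n * nint (n * (β / α)) ≤ c) ∨
      ∃ᶠ n : ℕ in atTop, (n : ℝ) * Real.log n * nint (n * (α / β)) ≤ c := by
    rw [← frequently_or_distrib]
    refine hc.mono fun n hn => ?_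
    rcases min_choice (nint ((n : ℝ) * (β / α))) (nint ((n : ℝ) * (α / β))) with h | h
    · exact Or.inl (h ▸ hn)
    · exact Or.inr (h ▸ hn)
  rcases hor with h | h
  · refine ae_eq_zero_of_periodic_of_decay (inv_pos.2 (abs_pos.2 hα))
      (periodic_add_mul_e (d 0) (d 2) hα) hβ h13 ⟨c, ?_⟩ hf heq' hdecay
    simpa only [nint_mul_abs_inv] using h
  · have hneg : ∀ {q : ℝ → Prop}, (∀ᵐ x : ℝ, q x) → ∀ᵐ x : ℝ, q (-x) := fun hq =>
      (Measure.measurePreserving_neg volume).quasiMeasurePreserving.ae hq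
    have hsub : ∀ {q : ℝ → Prop}, (∀ᵐ x : ℝ, q x) → ∀ᵐ x : ℝ, q (x - 1) := fun hq =>
      (measurePreserving_sub_right volume (1 : ℝ)).quasiMeasurePreserving.ae hq
    have key : ∀ᵐ x : ℝ, f (-x) = 0 := by
      refine ae_eq_zero_of_periodic_of_decay (f := fun x => f (-x)) (β := -α)
        (a := d 0) (b := d 2 * e (-α))
        (inv_pos.2 (abs_pos.2 (neg_ne_zero.2 hβ)))
        (periodic_add_mul_e (d 1) (d 3 * e (-β)) (neg_ne_zero.2 hβ)) (neg_ne_zero.2 hα) ?_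
        ⟨c, ?_⟩ (hf.comp measurable_neg) ?_ ?_
      · have : e (-α) ≠ 0 := norm_ne_zero_iff.1 (by rw [norm_e]; exact one_ne_zero)
        simpa [this] using h02
      · simpa only [nint_mul_abs_inv, neg_div_neg_eq] using h
      · filter_upwards [hneg (hsub heq')] with x hx
        rw [← hx, mul_assoc, mul_assoc, ← e_add, ← e_add]
        ring_nf
      · filter_upwards [hneg hdecay] with x hx
        refine ⟨?_, ?_⟩
        · simpa [Function.comp_def, neg_add, add_comm] using hx.2.comp tendsto_neg_atTop_atBot
        · simpa [Function.comp_def, neg_add, add_comm] using hx.1.comp tendsto_neg_atBot_atTop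
    simpa using hneg key
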